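/- Let f ∈ 𝒜, let m be a positive real number, and let α, β, c be real numbers with α < 0, c ≠ -1, c ≤ m, -1 < c ≤ m - α(m+1), and |β - (m+1)/2| < (m+1)/2. If for all z ∈ 𝒰 the inequalities Re f'(z) > ((m - c)/(α(m+1))) |f'(z)|² and |(β - 1) z f'(z)/f(z) + z f''(z)/(f'(z) - α) - (m-1)/2| ≤ (m+1)/2 hold, then the function f is univalent in 𝒰. -/

import Mathlib

open Complex Metric Set

noncomputable section

/-- The open unit disk in the complex plane. -/
def unitDisk : Set ℂ := Metric.ball 0 1

/-- The class `𝒜` of normalized analytic functions on the unit disk: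
`f` is analytic on `𝒰`, `f 0 = 0` and `f' 0 = 1`. -/
def MemA (f : ℂ → ℂ) : Prop :=
  AnalyticOn ℂ f unitDisk ∧ f 0 = 0 ∧ deriv f 0 = 1


open Filter Topology

/-- A real function with positive derivative is smaller just to the left of the point. -/
lemma eventually_lt_nhdsLT_of_hasDerivAt_pos {g : ℝ → ℝ} {d t : ℝ} (h : HasDerivAt g d t)
    (hd : 0 < d) : ∀ᶠ s in 𝓝[<] t, g s < g t := by
  have h1 := (hasDerivAt_iff_tendsto_slope.1 h).mono_left
    (nhdsWithin_mono t (fun s (hs : s < t) => hs.ne))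
  filter_upwards [h1.eventually (lt_mem_nhds hd), self_mem_nhdsWithin] with s hs hst
  rw [slope_def_field] at hs
  have : s - t < 0 := sub_neg.2 hst
  by_contra! hcon
  exact absurd hs (not_lt.2 (div_nonpos_of_nonneg_of_nonpos (by linarith) this.le))

lemma hasDerivAt_normSq_comp {φ : ℝ → ℂ} {w v : ℂ} {t : ℝ} (h : HasDerivAt φ (w * v) t)
    (hw : φ t = w) :
    HasDerivAt (fun s => ‖φ s‖ ^ 2) (2 * ‖w‖ ^ 2 * v.re) t := by
  have := h.norm_sq
  convert this using 1
  rw [hw, Complex.inner, ← Complex.normSq_eq_norm_sq]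
  simp [Complex.normSq_apply]
  ring

/-- A curve whose modulus grows logarithmically faster than `t ^ k` stays, going backwards in time,
inside the region `‖w‖ ≤ r * t ^ k`. -/
lemma eventually_norm_le_nhdsLT {φ : ℝ → ℂ} {w v : ℂ} {t r k : ℝ} (h : HasDerivAt φ (w * v) t)
    (hw : φ t = w) (ht : 0 < t) (hr : 0 < r) (hwr : ‖w‖ ≤ r * t ^ k) (hv : k / t < v.re) :
    ∀ᶠ s in 𝓝[<] t, ‖φ s‖ ≤ r * s ^ k := by
  have hpow : HasDerivAt (fun s : ℝ => r * s ^ k) (r * (k * t ^ (k - 1))) t :=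
    (Real.hasDerivAt_rpow_const (Or.inl ht.ne')).const_mul r
  have hpos : ∀ᶠ s in 𝓝[<] t, 0 < s := nhdsWithin_le_nhds (lt_mem_nhds ht)
  have htk : 0 < r * t ^ k := by positivity
  rcases hwr.lt_or_eq with hlt | heq
  · have h1 : Tendsto (fun s => ‖φ s‖) (𝓝 t) (𝓝 ‖w‖) := by
      simpa [hw] using h.continuousAt.norm.tendsto
    exact nhdsWithin_le_nhds ((h1.eventually_lt hpow.continuousAt.tendsto hlt).mono
      fun _ hs => hs.le)
  · have hd := (hasDerivAt_normSq_comp h hw).sub (hpow.pow 2)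
    have hlt := eventually_lt_nhdsLT_of_hasDerivAt_pos hd (by
      have h2 : t ^ (k - 1) = t ^ k / t := Real.rpow_sub_one ht.ne' k
      have h3 : (0 : ℝ) < 2 * (r * t ^ k) ^ 2 * (v.re - k / t) := by
        have := sub_pos.2 hv
        positivity
      rw [h2, heq]
      convert h3 using 1
      simp
      field_simp)
    filter_upwards [hlt, hpos] with s hs hs0
    simp only [Pi.sub_apply, Pi.pow_apply, hw, heq, sub_self] at hs
    have : 0 ≤ r * s ^ k := by positivity
    exact (pow_le_pow_iff_left₀ (norm_nonneg _) this two_ne_zero).1 (by linarith)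

section Implicit

variable {H : ℂ × ℂ → ℂ} {l w a b : ℂ}

lemma fderiv_apply_of_partial (hH : DifferentiableAt ℂ H (l, w))
    (ha : HasDerivAt (fun z => H (l, z)) a w) (hb : HasDerivAt (fun s => H (s, w)) b l)
    (x y : ℂ) : fderiv ℂ H (l, w) (x, y) = x * b + y * a := by
  have h1 : HasDerivAt (fun z => H (l, z)) (fderiv ℂ H (l, w) (0, 1)) w :=
    HasFDerivAt.comp_hasDerivAt (f := fun z : ℂ => (l, z)) w hH.hasFDerivAt
      ((hasDerivAt_const w l).prodMk (hasDerivAt_id w))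
  have h2 : HasDerivAt (fun s => H (s, w)) (fderiv ℂ H (l, w) (1, 0)) l :=
    HasFDerivAt.comp_hasDerivAt (f := fun s : ℂ => (s, w)) l hH.hasFDerivAt
      ((hasDerivAt_id l).prodMk (hasDerivAt_const l w))
  have e : ((x, y) : ℂ × ℂ) = x • (1, 0) + y • (0, 1) := by simp
  rw [e, map_add, map_smul, map_smul, ← ha.unique h1, ← hb.unique h2]
  simp

/-- An analytic family is locally injective, uniformly in the parameter, where the partial
derivative does not vanish. -/
lemma eventually_injective_of_partial_ne_zero (hH : AnalyticAt ℂ H (l, w))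
    (ha : HasDerivAt (fun z => H (l, z)) a w) (ha0 : a ≠ 0) :
    ∀ᶠ q : ℂ × ℂ × ℂ in 𝓝 (l, w, w), H (q.1, q.2.1) = H (q.1, q.2.2) → q.2.1 = q.2.2 := by
  have hb : HasDerivAt (fun s => H (s, w)) (deriv (fun s => H (s, w)) l) l := by
    refine DifferentiableAt.hasDerivAt ?_
    exact DifferentiableAt.comp (g := H) (f := fun s : ℂ => (s, w)) l
      hH.differentiableAt (by fun_prop)
  have hs := hH.hasStrictFDerivAt.isLittleO
  have h1 := hs.def (c := ‖a‖ / 2) (by positivity)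
  have ht : Tendsto (fun q : ℂ × ℂ × ℂ => ((q.1, q.2.1), (q.1, q.2.2))) (𝓝 (l, w, w))
      (𝓝 ((l, w), (l, w))) := by
    have : Continuous (fun q : ℂ × ℂ × ℂ => ((q.1, q.2.1), (q.1, q.2.2))) := by fun_prop
    exact this.tendsto _
  filter_upwards [ht.eventually h1] with q hq heq
  have e : ((q.1, q.2.1) : ℂ × ℂ) - (q.1, q.2.2) = (0, q.2.1 - q.2.2) := by simp
  simp only [heq, sub_self, zero_sub, norm_neg] at hq
  rw [e, fderiv_apply_of_partial hH.differentiableAt ha hb] at hq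
  simp only [zero_mul, zero_add, norm_mul, Prod.norm_mk, norm_zero] at hq
  rw [max_eq_right (norm_nonneg _)] at hq
  have ha1 : 0 < ‖a‖ := norm_pos_iff.2 ha0
  have : ‖q.2.1 - q.2.2‖ ≤ 0 := by nlinarith
  exact sub_eq_zero.1 (norm_le_zero_iff.1 this)

/-- The level curve of an analytic function of two variables, with its derivative. -/
lemma exists_level_curve (hH : AnalyticAt ℂ H (l, w))
    (ha : HasDerivAt (fun z => H (l, z)) a w) (ha0 : a ≠ 0)
    (hb : HasDerivAt (fun s => H (s, w)) b l) :
    ∃ φ : ℂ → ℂ, φ l = w ∧ HasDerivAt φ (-b / a) l ∧ ∀ᶠ s in 𝓝 l, H (s, φ s) = H (l, w) := by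
  have hfd := fderiv_apply_of_partial hH.differentiableAt ha hb
  have hc : ContDiffAt ℂ 1 H (l, w) := hH.contDiffAt
  have hinv : (fderiv ℂ H (l, w) ∘L .inr ℂ ℂ ℂ).IsInvertible := by
    refine ⟨ContinuousLinearEquiv.unitsEquivAut ℂ (Units.mk0 a ha0), ?_⟩
    ext
    simp [hfd]
  have hφl := hc.implicitFunction_apply_self one_ne_zero hinv
  have hder := (hc.hasStrictFDerivAt_implicitFunction one_ne_zero hinv).hasFDerivAt
  have hev := hc.eventually_apply_implicitFunction one_ne_zero hinv
  refine ⟨_, hφl, ?_, hev⟩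
  set φ := hc.implicitFunction one_ne_zero hinv
  have hφ : DifferentiableAt ℂ φ l := hder.differentiableAt
  have hcomp : HasDerivAt (fun s => H (s, φ s)) (fderiv ℂ H (l, w) (1, deriv φ l)) l := by
    have h0 : HasFDerivAt H (fderiv ℂ H (l, w)) (l, φ l) := by
      rw [show φ l = w from hφl]; exact hH.differentiableAt.hasFDerivAt
    exact HasFDerivAt.comp_hasDerivAt (f := fun s : ℂ => (s, φ s)) l h0
      ((hasDerivAt_id l).prodMk hφ.hasDerivAt)
  have hz := hcomp.unique
    ((hasDerivAt_const l (H (l, w))).congr_of_eventuallyEq hev)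
  rw [hfd] at hz
  have : deriv φ l = -b / a := by
    rw [eq_div_iff ha0]; linear_combination hz
  exact this ▸ hφ.hasDerivAt

end Implicit

/-- If an analytic function moves to the right along rays whenever it takes a nonpositive real
value, then it omits the nonpositive reals. -/
lemma mem_slitPlane_of_radial_deriv {Y : ℂ → ℂ} (hY : AnalyticOnNhd ℂ Y (ball 0 1))
    (h : ∀ w ∈ ball (0 : ℂ) 1, ∀ t : ℝ, t ≤ 0 → Y w = t → 0 < (w * deriv Y w).re)
    {w₁ : ℂ} (hw₁ : w₁ ∈ ball (0 : ℂ) 1) : Y w₁ ∈ slitPlane := by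
  by_contra hcon
  have hsub : closedBall (0 : ℂ) ‖w₁‖ ⊆ ball 0 1 :=
    closedBall_subset_ball (by simpa using hw₁)
  have hcont : ContinuousOn Y (closedBall 0 ‖w₁‖) := hY.continuousOn.mono hsub
  have hcpt : IsCompact (closedBall (0 : ℂ) ‖w₁‖ ∩ Y ⁻¹' slitPlaneᶜ) :=
    (isCompact_closedBall _ _).of_isClosed_subset
      (hcont.preimage_isClosed_of_isClosed isClosed_closedBall
        isOpen_slitPlane.isClosed_compl) inter_subset_left
  obtain ⟨w, ⟨hwb, hwY⟩, hmin⟩ := hcpt.exists_isMinOn (f := fun z => ‖z‖)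
    ⟨w₁, by simp, hcon⟩ continuous_norm.continuousOn
  have hw1 := hsub hwb
  simp only [mem_preimage, mem_compl_iff, mem_slitPlane_iff, not_or, not_lt, not_not] at hwY
  obtain ⟨ht, him⟩ := hwY
  obtain ⟨t, hYt⟩ : ∃ t : ℝ, Y w = t := ⟨(Y w).re, Complex.ext (by simp) (by simpa using him)⟩
  rw [hYt, Complex.ofReal_re] at ht
  have hpos := h w hw1 t ht hYt
  have hne : w * deriv Y w ≠ 0 := fun h => by simp [h] at hpos
  have hw0 : w ≠ 0 := left_ne_zero_of_mul hne
  have hd0 : deriv Y w ≠ 0 := right_ne_zero_of_mul hne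
  have hYd := (hY w hw1).differentiableAt.hasDerivAt
  have hA : AnalyticAt ℂ (fun p : ℂ × ℂ => Y p.2 - p.1) ((t : ℂ), w) :=
    (AnalyticAt.fun_comp (g := Y) (hY w hw1) analyticAt_snd).sub analyticAt_fst
  obtain ⟨φ, hφ, hφd, hφe⟩ := exists_level_curve hA (a := deriv Y w) (b := -1)
    (hYd.sub_const _) hd0 (by simpa using (hasDerivAt_id (t : ℂ)).const_sub (Y w))
  have hψ : HasDerivAt (fun s : ℝ => φ s) (w * (w * deriv Y w)⁻¹) t := by
    have := hφd.comp_ofReal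
    convert this using 1
    field_simp
  have hn := eventually_lt_nhdsLT_of_hasDerivAt_pos (hasDerivAt_normSq_comp hψ hφ) (by
    have h1 : 0 < ‖w‖ := norm_pos_iff.2 hw0
    have h2 : 0 < ((w * deriv Y w)⁻¹).re := by
      rw [Complex.inv_re]; exact div_pos hpos (Complex.normSq_pos.2 hne)
    positivity)
  have he : ∀ᶠ s : ℝ in 𝓝[<] t, Y (φ s) - s = Y w - t :=
    nhdsWithin_le_nhds ((Complex.continuous_ofReal.tendsto t).eventually hφe)
  obtain ⟨s, ⟨hs1, hs2⟩, hst⟩ := ((hn.and he).and self_mem_nhdsWithin).exists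
  have hst : s < t := hst
  simp only [hφ] at hs1
  have hs3 : ‖φ s‖ < ‖w‖ := lt_of_pow_lt_pow_left₀ 2 (norm_nonneg _) hs1
  have hYs : Y (φ s) = s := by rw [hYt, sub_self] at hs2; exact sub_eq_zero.1 hs2
  refine not_lt.2 (hmin (a := φ s) ⟨?_, ?_⟩) hs3
  · have : ‖w‖ ≤ ‖w₁‖ := by simpa using hwb
    simpa using hs3.le.trans this
  · simp only [mem_preimage, mem_compl_iff, hYs, Complex.ofReal_mem_slitPlane]
    linarith

/-- A curve along which `s ^ (-b) * H (s, ·)` is constant. -/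
lemma exists_scaled_level_curve {H : ℂ × ℂ → ℂ} {l b : ℝ} {w a v : ℂ} (hl : 0 < l)
    (hH : AnalyticAt ℂ H ((l : ℂ), w))
    (ha : HasDerivAt (fun z => H (l, z)) a w) (ha0 : a ≠ 0)
    (hb : HasDerivAt (fun s => H (s, w)) (b * H (l, w) / l - a * (w * v)) l) :
    ∃ φ : ℝ → ℂ, φ l = w ∧ HasDerivAt φ (w * v) l ∧
      ∀ᶠ s : ℝ in 𝓝 l, H (s, φ s) = exp (b * log s) * (exp (-b * log l) * H (l, w)) := by
  have hls : (l : ℂ) ∈ slitPlane := Complex.ofReal_mem_slitPlane.2 hl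
  have hl0 : (l : ℂ) ≠ 0 := slitPlane_ne_zero hls
  have hE : AnalyticAt ℂ (fun p : ℂ × ℂ => exp (-b * log p.1) * H p) ((l : ℂ), w) :=
    ((analyticAt_const.mul (analyticAt_fst.clog hls)).cexp).mul hH
  have hEd : HasDerivAt (fun s : ℂ => exp (-b * log s)) (exp (-b * log l) * (-b * (l : ℂ)⁻¹)) l :=
    ((Complex.hasDerivAt_log hls).const_mul _).cexp
  obtain ⟨φ, hφ, hφd, hφe⟩ := exists_level_curve hE
    (ha.const_mul (exp (-b * log (l : ℂ))))
    (mul_ne_zero (exp_ne_zero _) ha0) (hEd.mul hb)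
  refine ⟨fun s => φ s, hφ, ?_, ?_⟩
  · convert hφd.comp_ofReal using 1
    have := exp_ne_zero (-b * log (l : ℂ))
    field_simp
    ring
  · filter_upwards [(Complex.continuous_ofReal.tendsto l).eventually hφe] with s hs
    rw [← hs, ← mul_assoc, ← exp_add]
    simp

/-- A Loewner-type univalence criterion: a family of analytic functions whose rescaled level curves
contract at a definite rate towards the origin starts with a univalent function. -/
lemma injOn_of_contracting_level_curves {H : ℂ × ℂ → ℂ} {a v : ℝ → ℂ → ℂ} {b k : ℝ} (hk : 0 < k)
    (hH : ∀ l ∈ Icc (0 : ℝ) 1, ∀ w ∈ ball (0 : ℂ) 1, AnalyticAt ℂ H ((l : ℂ), w))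
    (ha : ∀ l ∈ Icc (0 : ℝ) 1, ∀ w ∈ ball (0 : ℂ) 1,
      HasDerivAt (fun z => H ((l : ℂ), z)) (a l w) w)
    (ha0 : ∀ l ∈ Icc (0 : ℝ) 1, ∀ w ∈ ball (0 : ℂ) 1, (l = 0 → w = 0) → a l w ≠ 0)
    (hb : ∀ l ∈ Ioc (0 : ℝ) 1, ∀ w ∈ ball (0 : ℂ) 1,
      HasDerivAt (fun s => H (s, w)) (b * H ((l : ℂ), w) / l - a l w * (w * v l w)) l)
    (hv : ∀ l ∈ Ioc (0 : ℝ) 1, ∀ w ∈ ball (0 : ℂ) 1, k / l < (v l w).re) :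
    InjOn (fun w => H (1, w)) (ball 0 1) := by
  intro z₁ hz₁ z₂ hz₂ hz
  by_contra hne
  have hz₁' : ‖z₁‖ < 1 := by simpa using hz₁
  have hz₂' : ‖z₂‖ < 1 := by simpa using hz₂
  obtain ⟨r, hr0, hr1, hr₁, hr₂⟩ : ∃ r : ℝ, 0 < r ∧ r < 1 ∧ ‖z₁‖ ≤ r ∧ ‖z₂‖ ≤ r := by
    refine ⟨(max ‖z₁‖ ‖z₂‖ + 1) / 2, ?_, ?_, ?_, ?_⟩
    · have := norm_nonneg z₁
      have := le_max_left ‖z₁‖ ‖z₂‖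
      linarith
    · have := max_lt hz₁' hz₂'
      linarith
    · have := le_max_left ‖z₁‖ ‖z₂‖
      linarith
    · have := le_max_right ‖z₁‖ ‖z₂‖
      linarith
  have hrpow : ∀ l ∈ Icc (0 : ℝ) 1, r * l ^ k ≤ r := fun l hl =>
    mul_le_of_le_one_right hr0.le (Real.rpow_le_one hl.1 hl.2 hk.le)
  have hball : ∀ l ∈ Icc (0 : ℝ) 1, ∀ w : ℂ, ‖w‖ ≤ r * l ^ k → w ∈ ball (0 : ℂ) 1 := by
    intro l hl w hw
    simpa using (hw.trans (hrpow l hl)).trans_lt hr1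
  have hzero : ∀ (l : ℝ) (w : ℂ), ‖w‖ ≤ r * l ^ k → l = 0 → w = 0 := by
    rintro l w hw rfl
    rw [Real.zero_rpow hk.ne', mul_zero] at hw
    exact norm_le_zero_iff.1 hw
  let C : Set (ℝ × ℂ × ℂ) :=
    {q | q.1 ∈ Icc (0 : ℝ) 1 ∧ ‖q.2.1‖ ≤ r * q.1 ^ k ∧ ‖q.2.2‖ ≤ r * q.1 ^ k}
  have hpc : Continuous fun q : ℝ × ℂ × ℂ => r * q.1 ^ k :=
    continuous_const.mul (continuous_fst.rpow_const fun _ => Or.inr hk.le)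
  have hCcl : IsClosed C :=
    (isClosed_Icc.preimage continuous_fst).inter
      ((isClosed_le (by fun_prop) hpc).inter (isClosed_le (by fun_prop) hpc))
  have hC : IsCompact C := by
    refine ((isCompact_Icc (a := (0 : ℝ)) (b := 1)).prod ((isCompact_closedBall (0 : ℂ) r).prod
      (isCompact_closedBall (0 : ℂ) r))).of_isClosed_subset hCcl ?_
    rintro q ⟨h1, h2, h3⟩
    exact ⟨h1, by simpa using h2.trans (hrpow _ h1), by simpa using h3.trans (hrpow _ h1)⟩
  let D : ℝ × ℂ × ℂ → ℂ := fun q => H (q.1, q.2.1) - H (q.1, q.2.2)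
  have hD : ContinuousOn D C := by
    rintro q ⟨h1, h2, h3⟩
    have e1 := (hH _ h1 _ (hball _ h1 _ h2)).continuousAt
    have e2 := (hH _ h1 _ (hball _ h1 _ h3)).continuousAt
    have c1 : ContinuousAt (fun q : ℝ × ℂ × ℂ => ((q.1 : ℂ), q.2.1)) q := by fun_prop
    have c2 : ContinuousAt (fun q : ℝ × ℂ × ℂ => ((q.1 : ℂ), q.2.2)) q := by fun_prop
    exact ((ContinuousAt.comp (g := H) (f := fun q : ℝ × ℂ × ℂ => ((q.1 : ℂ), q.2.1)) e1 c1).sub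
      (ContinuousAt.comp (g := H) (f := fun q : ℝ × ℂ × ℂ => ((q.1 : ℂ), q.2.2))
        e2 c2)).continuousWithinAt
  have hZcl : IsClosed (C ∩ D ⁻¹' {0}) :=
    hD.preimage_isClosed_of_isClosed hCcl isClosed_singleton
  let K : Set (ℝ × ℂ × ℂ) := {q | q ∈ C ∩ D ⁻¹' {0} ∧ q.2.1 ≠ q.2.2}
  have hKcl : IsClosed K := by
    refine isClosed_of_closure_subset fun q hq => ?_
    have hqZ : q ∈ C ∩ D ⁻¹' {0} := closure_minimal (fun x hx => hx.1) hZcl hq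
    refine ⟨hqZ, fun heq => ?_⟩
    obtain ⟨⟨h1, h2, -⟩, -⟩ := hqZ
    have hw := hball _ h1 _ h2
    have hev := eventually_injective_of_partial_ne_zero (hH _ h1 _ hw) (ha _ h1 _ hw)
      (ha0 _ h1 _ hw (hzero _ _ h2))
    have hc : Tendsto (fun x : ℝ × ℂ × ℂ => ((x.1 : ℂ), x.2.1, x.2.2)) (𝓝 q)
        (𝓝 ((q.1 : ℂ), q.2.1, q.2.1)) := by
      have : Continuous (fun x : ℝ × ℂ × ℂ => ((x.1 : ℂ), x.2.1, x.2.2)) := by fun_prop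
      simpa [← heq] using this.tendsto q
    obtain ⟨x, hx, hinj⟩ := ((mem_closure_iff_frequently.1 hq).and_eventually
      (hc.eventually hev)).exists
    exact hx.2 (hinj (sub_eq_zero.1 hx.1.2))
  have hK : IsCompact K := hC.of_isClosed_subset hKcl fun x hx => hx.1.1
  obtain ⟨⟨l, w₁, w₂⟩, ⟨⟨⟨hl, h1, h2⟩, hHeq⟩, hwne⟩, hmin⟩ := hK.exists_isMinOn (f := Prod.fst)
    ⟨(1, z₁, z₂), ⟨⟨by simp, by simpa using hr₁, by simpa using hr₂⟩,
      by simpa [D, sub_eq_zero] using hz⟩, hne⟩ continuous_fst.continuousOn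
  simp only at hl h1 h2 hwne
  have hHeq : H (l, w₁) = H (l, w₂) := sub_eq_zero.1 hHeq
  have hl0 : 0 < l := by
    refine hl.1.lt_of_ne' fun h => hwne ?_
    rw [hzero _ _ h1 h, hzero _ _ h2 h]
  have hl' : l ∈ Ioc (0 : ℝ) 1 := ⟨hl0, hl.2⟩
  have hb₁ := hball _ hl _ h1
  have hb₂ := hball _ hl _ h2
  obtain ⟨φ₁, e₁, d₁, c₁⟩ := exists_scaled_level_curve hl0 (hH l hl _ hb₁) (ha l hl _ hb₁)
    (ha0 l hl _ hb₁ (hzero _ _ h1)) (hb l hl' _ hb₁)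
  obtain ⟨φ₂, e₂, d₂, c₂⟩ := exists_scaled_level_curve hl0 (hH l hl _ hb₂) (ha l hl _ hb₂)
    (ha0 l hl _ hb₂ (hzero _ _ h2)) (hb l hl' _ hb₂)
  have n₁ := eventually_norm_le_nhdsLT d₁ e₁ hl0 hr0 h1 (hv l hl' _ hb₁)
  have n₂ := eventually_norm_le_nhdsLT d₂ e₂ hl0 hr0 h2 (hv l hl' _ hb₂)
  have hne' : ∀ᶠ s in 𝓝 l, φ₁ s ≠ φ₂ s :=
    ((d₁.continuousAt.sub d₂.continuousAt).eventually_ne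
      (sub_ne_zero.2 (by rwa [e₁, e₂]))).mono fun s hs => sub_ne_zero.1 hs
  obtain ⟨s, ⟨⟨⟨⟨⟨s1, s2⟩, s3⟩, s4⟩, s5⟩, s6⟩, hsl⟩ := ((((((n₁.and n₂).and
    (nhdsWithin_le_nhds c₁)).and (nhdsWithin_le_nhds c₂)).and (nhdsWithin_le_nhds hne')).and
    (nhdsWithin_le_nhds (lt_mem_nhds hl0))).and self_mem_nhdsWithin).exists
  have hsl : s < l := hsl
  refine not_lt.2 (hmin (a := (s, φ₁ s, φ₂ s))
    ⟨⟨⟨⟨s6.le, hsl.le.trans hl.2⟩, s1, s2⟩, ?_⟩, s5⟩) hsl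
  simp [D, s3, s4, hHeq]

lemma norm_sub_ofReal_lt_iff {z : ℂ} {R : ℝ} (hR : 0 < R) :
    ‖z - R‖ < R ↔ ‖z‖ ^ 2 < 2 * R * z.re := by
  rw [← sq_lt_sq₀ (norm_nonneg _) hR.le, Complex.sq_norm, Complex.sq_norm, Complex.normSq_apply,
    Complex.normSq_apply]
  simp only [sub_re, ofReal_re, sub_im, ofReal_im, sub_zero]
  constructor <;> intro h <;> nlinarith

lemma re_nonneg_of_norm_sub_ofReal_le {z : ℂ} {R : ℝ} (h : ‖z - R‖ ≤ R) : 0 ≤ z.re := by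
  have := (abs_le.1 ((Complex.abs_re_le_norm _).trans h)).1
  simp at this
  linarith

lemma lt_re_inv_of_norm_sub_ofReal_lt {z : ℂ} {R : ℝ} (hR : 0 < R) (h : ‖z - R‖ < R) :
    1 / (2 * R) < (z⁻¹).re := by
  have h1 := (norm_sub_ofReal_lt_iff hR).1 h
  have hz : z ≠ 0 := by rintro rfl; simp at h1
  have h2 : 0 < normSq z := Complex.normSq_pos.2 hz
  rw [Complex.sq_norm] at h1
  rw [Complex.inv_re, div_lt_div_iff₀ (by positivity) h2]
  linarith


lemma norm_quotient_sub_lt {m α c : ℝ} {d : ℂ} (hm : 0 < m) (hα : α < 0) (hc1 : -1 < c)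
    (h : (m - c) / (α * (m + 1)) * ‖d‖ ^ 2 < d.re) :
    d ≠ 0 ∧ d - α ≠ 0 ∧ ‖(1 + c) * d / (d - α) - ((m + 1) / 2 : ℝ)‖ < (m + 1) / 2 := by
  have hd : d ≠ 0 := by rintro rfl; simp at h
  have hk : 0 < -α * (m + 1) := mul_pos (by linarith) (by linarith)
  have hmul : -((m - c) * ‖d‖ ^ 2) < -α * (m + 1) * d.re := by
    have h1 := mul_lt_mul_of_pos_left h hk
    have h2 : -α * (m + 1) * ((m - c) / (α * (m + 1)) * ‖d‖ ^ 2) = -((m - c) * ‖d‖ ^ 2) := by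
      have : m + 1 ≠ 0 := by linarith
      have : α ≠ 0 := hα.ne
      field_simp
    linarith
  have hq : d - α ≠ 0 := by
    intro h0
    rw [sub_eq_zero.1 h0] at hmul
    simp only [norm_real, Real.norm_eq_abs, sq_abs, ofReal_re] at hmul
    nlinarith [mul_pos (by linarith : 0 < 1 + c) (mul_pos_of_neg_of_neg hα hα)]
  refine ⟨hd, hq, (norm_sub_ofReal_lt_iff (by linarith)).2 ?_⟩
  have hqs : 0 < normSq (d - α) := Complex.normSq_pos.2 hq
  rw [Complex.sq_norm] at hmul ⊢
  have e1 : normSq ((1 + c) * d / (d - α)) = (1 + c) ^ 2 * normSq d / normSq (d - α) := by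
    have : ((1 : ℂ) + c) = ((1 + c : ℝ) : ℂ) := by push_cast; rfl
    rw [normSq_div, normSq_mul, this, normSq_ofReal]
    ring
  have e2 : ((1 + c) * d / (d - α)).re
      = (1 + c) * (normSq d - α * d.re) / normSq (d - α) := by
    have : ((1 : ℂ) + c) = ((1 + c : ℝ) : ℂ) := by push_cast; rfl
    rw [mul_div_assoc, this, re_ofReal_mul, Complex.div_re, normSq_apply d]
    simp
    ring
  rw [e1, e2, ← mul_div_assoc, div_lt_div_iff_of_pos_right hqs]
  have := mul_lt_mul_of_pos_left hmul (by linarith : 0 < 1 + c)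
  nlinarith


/-- If `(β - 1) * (z * f' / f) + k` stays bounded near a point where `f' ≠ 0`, then that point is
not a zero of `f`. -/
lemma ne_zero_of_norm_logDeriv_le {f k : ℂ → ℂ} {β w : ℂ} {R : ℝ} (hβ : β ≠ 1) (hw : w ≠ 0)
    (hf : DifferentiableAt ℂ f w) (hf' : ContinuousAt (deriv f) w) (hk : ContinuousAt k w)
    (hd : deriv f w ≠ 0) (h : ∀ᶠ z in 𝓝 w, ‖(β - 1) * (z * deriv f z / f z) + k z‖ ≤ R) :
    f w ≠ 0 := by
  intro hfw
  have hne : ∀ᶠ z in 𝓝[≠] w, f z ≠ 0 := hf.hasDerivAt.eventually_ne hd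
  have hG : ContinuousAt (fun z => ‖(β - 1) * (z * deriv f z) + k z * f z‖) w := by
    have := hf.continuousAt
    fun_prop
  have hR : ContinuousAt (fun z => R * ‖f z‖) w := continuousAt_const.mul hf.continuousAt.norm
  have hle := le_of_tendsto_of_tendsto (hG.tendsto.mono_left (nhdsWithin_le_nhds (s := {w}ᶜ)))
    (hR.tendsto.mono_left nhdsWithin_le_nhds) (by
      filter_upwards [hne, nhdsWithin_le_nhds h] with z hz hb
      have := mul_le_mul_of_nonneg_right hb (norm_nonneg (f z))
      rw [← norm_mul] at this
      convert this using 2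
      field_simp)
  simp only [hfw, mul_zero, add_zero, norm_zero] at hle
  have := norm_le_zero_iff.1 hle
  simp [sub_eq_zero, hβ, hw, hd] at this

theorem stmt7 (f : ℂ → ℂ) (m : ℝ) (hm : 0 < m) (α β c : ℝ)
    (hfA : MemA f)
    (hα : α < 0) (hc : c ≠ -1) (hcm : c ≤ m) (hc1 : -1 < c) (hc2 : c ≤ m - α * (m + 1))
    (hβ : |β - (m + 1) / 2| < (m + 1) / 2)
    (h1 : ∀ z ∈ unitDisk,
      (deriv f z).re > (m - c) / (α * (m + 1)) * ‖deriv f z‖ ^ 2)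
    (h2 : ∀ z ∈ unitDisk,
      ‖((β : ℂ) - 1) * (z * deriv f z / f z)
        + z * deriv (deriv f) z / (deriv f z - (α : ℂ)) - ((m : ℂ) - 1) / 2‖ ≤ (m + 1) / 2) :
    Set.InjOn f unitDisk := by
  obtain ⟨hfan, hf0, hf'0⟩ := hfA
  simp only [unitDisk] at *
  have hRpos : 0 < (m + 1) / 2 := by linarith
  have hβ0 : 0 < β := by linarith [(abs_lt.1 hβ).1]
  have hβc : (β : ℂ) ≠ 0 := Complex.ofReal_ne_zero.2 hβ0.ne'
  have hcc : (1 + c : ℂ) ≠ 0 := by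
    have : (1 + c : ℝ) ≠ 0 := by linarith
    exact_mod_cast this
  have hf : AnalyticOnNhd ℂ f (ball 0 1) := isOpen_ball.analyticOn_iff_analyticOnNhd.1 hfan
  have hf' : AnalyticOnNhd ℂ (deriv f) (ball 0 1) := hf.deriv
  have hA : ∀ w ∈ ball (0 : ℂ) 1, deriv f w ≠ 0 ∧ deriv f w - α ≠ 0 ∧
      ‖(1 + c) * deriv f w / (deriv f w - α) - ((m + 1) / 2 : ℝ)‖ < (m + 1) / 2 :=
    fun w hw => norm_quotient_sub_lt hm hα hc1 (h1 w hw)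
  set p : ℂ → ℂ := dslope f 0 with hpdef
  have hp : AnalyticOnNhd ℂ p (ball 0 1) :=
    ((Complex.differentiableOn_dslope (ball_mem_nhds 0 one_pos)).2
      hf.differentiableOn).analyticOnNhd isOpen_ball
  have hfp : ∀ z, f z = z * p z := fun z => by
    simpa [hf0] using (sub_smul_dslope f 0 z).symm
  have hp0 : p 0 = 1 := by rw [hpdef, dslope_same, hf'0]
  have hfd : ∀ w ∈ ball (0 : ℂ) 1, deriv f w = p w + w * deriv p w := by
    intro w hw
    have := (hasDerivAt_id w).mul (hp w hw).differentiableAt.hasDerivAt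
    rw [show f = id * p from funext hfp, this.deriv]
    simp
  have hpβ : ∀ w ∈ ball (0 : ℂ) 1, (β : ℂ) = 1 ∨ p w ≠ 0 := by
    intro w hw
    by_contra! hcon
    obtain ⟨hβ1, hpw⟩ := hcon
    have hw0 : w ≠ 0 := by rintro rfl; simp [hp0] at hpw
    have hc1 := (hf' w hw).continuousAt
    have hc2 := (hf' w hw).deriv.continuousAt
    refine ne_zero_of_norm_logDeriv_le (R := (m + 1) / 2)
      (k := fun z => z * deriv (deriv f) z / (deriv f z - (α : ℂ)) - ((m : ℂ) - 1) / 2)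
      hβ1 hw0 (hf w hw).differentiableAt hc1 ?_ (hA w hw).1 ?_ (by rw [hfp, hpw, mul_zero])
    · exact ((continuousAt_id.mul hc2).div (hc1.sub continuousAt_const)
        (hA w hw).2.1).sub continuousAt_const
    · filter_upwards [isOpen_ball.mem_nhds hw] with z hz
      simpa only [add_sub_assoc] using h2 z hz
  let A : ℂ → ℂ := fun w => (1 + c) * deriv f w / (deriv f w - α)
  let B : ℂ → ℂ := fun w =>
    (β - 1) * (deriv f w / p w) + 1 + w * deriv (deriv f) w / (deriv f w - α)
  have hB : ∀ w ∈ ball (0 : ℂ) 1, ‖B w - ((m + 1) / 2 : ℝ)‖ ≤ (m + 1) / 2 := by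
    intro w hw
    rcases eq_or_ne w 0 with rfl | hw0
    · have : B 0 - ((m + 1) / 2 : ℝ) = ((β - (m + 1) / 2 : ℝ) : ℂ) := by simp [B, hp0, hf'0]
      rw [this, norm_real]
      exact hβ.le
    · convert h2 w hw using 2
      rw [hfp, mul_div_mul_left _ _ hw0]
      simp only [B]
      push_cast
      ring
  have hp' : ∀ w ∈ ball (0 : ℂ) 1, HasDerivAt p (deriv p w) w :=
    fun w hw => (hp w hw).differentiableAt.hasDerivAt
  have hq' : ∀ w ∈ ball (0 : ℂ) 1,
      HasDerivAt (fun z => deriv f z - α) (deriv (deriv f) w) w :=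
    fun w hw => (hf' w hw).differentiableAt.hasDerivAt.sub_const _
  let Y : ℂ → ℂ := fun w => (1 + c) / β * (p w / (deriv f w - α))
  have hYan : AnalyticOnNhd ℂ Y (ball 0 1) := fun w hw =>
    analyticAt_const.mul ((hp w hw).div ((hf' w hw).sub analyticAt_const) (hA w hw).2.1)
  have hYd : ∀ w ∈ ball (0 : ℂ) 1, w * deriv Y w = A w - B w * Y w := by
    intro w hw
    have hq := (hA w hw).2.1
    have := (((hp' w hw).fun_div (hq' w hw) hq).const_mul ((1 + c) / β : ℂ)).deriv
    rw [this]
    have h3 := hfd w hw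
    simp only [A, B, Y]
    rcases hpβ w hw with hβ1 | hpw
    · rw [hβ1]
      field_simp
      linear_combination (-(deriv f w - α)) * h3
    · field_simp
      linear_combination (-(deriv f w - α)) * h3
  have hYs : ∀ w ∈ ball (0 : ℂ) 1, Y w ∈ slitPlane := by
    refine fun w hw => mem_slitPlane_of_radial_deriv hYan (fun z hz t ht hzt => ?_) hw
    rw [hYd z hz, hzt, mul_comm, sub_re, re_ofReal_mul]
    have e1 := lt_re_inv_of_norm_sub_ofReal_lt hRpos (hA z hz).2.2
    have e2 := re_nonneg_of_norm_sub_ofReal_le (hB z hz)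
    have e3 : 0 < (A z).re := by
      have h3 := (norm_sub_ofReal_lt_iff hRpos).1 (hA z hz).2.2
      have : 0 < 2 * ((m + 1) / 2) * (A z).re := (sq_nonneg _).trans_lt h3
      exact pos_of_mul_pos_right this (by linarith)
    nlinarith
  have hpne : ∀ w ∈ ball (0 : ℂ) 1, p w ≠ 0 := fun w hw hpw =>
    slitPlane_ne_zero (hYs w hw) (by simp [Y, hpw])
  let X : ℂ → ℂ := fun w => β / (1 + c) * ((deriv f w - α) / p w)
  have hXs : ∀ w ∈ ball (0 : ℂ) 1, X w ∈ slitPlane := by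
    intro w hw
    have : X w = (Y w)⁻¹ := by simp only [X, Y, mul_inv, inv_div]
    rw [this]
    have hn : 0 < normSq (Y w) := normSq_pos.2 (slitPlane_ne_zero (hYs w hw))
    refine (mem_slitPlane_iff.1 (hYs w hw)).imp (fun h => ?_) (fun h => ?_)
    · rw [Complex.inv_re]
      exact div_pos h hn
    · rw [Complex.inv_im]
      exact div_ne_zero (neg_ne_zero.2 h) hn.ne'
  let D : ℝ → ℂ → ℂ := fun l w => l + (1 - l) * X w
  have hDs : ∀ l ∈ Icc (0 : ℝ) 1, ∀ w ∈ ball (0 : ℂ) 1, D l w ∈ slitPlane := by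
    intro l hl w hw
    have := starConvex_one_slitPlane (hXs w hw) hl.1 (sub_nonneg.2 hl.2) (by ring)
    simpa [D] using this
  let N : ℝ → ℂ → ℂ := fun l w => l * A w + (1 - l) * B w
  have hN : ∀ l ∈ Ioc (0 : ℝ) 1, ∀ w ∈ ball (0 : ℂ) 1,
      ‖N l w - ((m + 1) / 2 : ℝ)‖ < (m + 1) / 2 := by
    intro l hl w hw
    have e : N l w - ((m + 1) / 2 : ℝ) = (l : ℂ) * (A w - ((m + 1) / 2 : ℝ))
        + ((1 - l : ℝ) : ℂ) * (B w - ((m + 1) / 2 : ℝ)) := by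
      simp only [N]; push_cast; ring
    have h3 : (A w - ((m + 1) / 2 : ℝ)) = (1 + c) * deriv f w / (deriv f w - α)
      - ((m + 1) / 2 : ℝ) := rfl
    have e3 := (hA w hw).2.2
    have e4 := hB w hw
    rw [e]
    refine (norm_add_le _ _).trans_lt ?_
    rw [norm_mul, norm_mul, norm_real, norm_real, Real.norm_of_nonneg hl.1.le,
      Real.norm_of_nonneg (sub_nonneg.2 hl.2), h3]
    have e5 := mul_lt_mul_of_pos_left e3 hl.1
    have e6 := mul_le_mul_of_nonneg_left e4 (sub_nonneg.2 hl.2)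
    linarith
  have hN0 : ∀ l ∈ Icc (0 : ℝ) 1, ∀ w ∈ ball (0 : ℂ) 1, (l = 0 → w = 0) → N l w ≠ 0 := by
    intro l hl w hw hlw h0
    rcases hl.1.eq_or_lt with rfl | hl0
    · obtain rfl := hlw rfl
      simp [N, B, hp0, hf'0, hβc] at h0
    · have := hN l ⟨hl0, hl.2⟩ w hw
      rw [h0, zero_sub, norm_neg, norm_real, Real.norm_of_nonneg hRpos.le] at this
      exact lt_irrefl _ this
  let b : ℝ := 1 / β
  let H : ℂ × ℂ → ℂ := fun x => f x.2 * exp (b * log (x.1 + (1 - x.1) * X x.2))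
  have hXan : AnalyticOnNhd ℂ X (ball 0 1) := fun w hw =>
    analyticAt_const.mul (((hf' w hw).sub analyticAt_const).div (hp w hw) (hpne w hw))
  have hXd : ∀ w ∈ ball (0 : ℂ) 1, HasDerivAt X (β / (1 + c) *
      ((deriv (deriv f) w * p w - (deriv f w - α) * deriv p w) / p w ^ 2)) w := fun w hw =>
    ((hq' w hw).fun_div (hp' w hw) (hpne w hw)).const_mul _
  have key := injOn_of_contracting_level_curves (H := H) (b := b) (k := 1 / (m + 1))
    (a := fun l w => exp (b * log (D l w)) * (p w * b * N l w * X w / D l w))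
    (v := fun l w => (l * N l w)⁻¹) (by positivity) ?_ ?_ ?_ ?_ ?_
  · simpa [H] using key
  · intro l hl w hw
    have hf2 : AnalyticAt ℂ (fun x : ℂ × ℂ => f x.2) ((l : ℂ), w) :=
      AnalyticAt.fun_comp (g := f) (hf w hw) analyticAt_snd
    have hX2 : AnalyticAt ℂ (fun x : ℂ × ℂ => X x.2) ((l : ℂ), w) :=
      AnalyticAt.fun_comp (g := X) (hXan w hw) analyticAt_snd
    exact hf2.mul (analyticAt_const.mul ((analyticAt_fst.add
      ((analyticAt_const.sub analyticAt_fst).mul hX2)).clog (hDs l hl w hw))).cexp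
  · intro l hl w hw
    have hD0 := slitPlane_ne_zero (hDs l hl w hw)
    have hDd : HasDerivAt (D l) _ w := ((hXd w hw).const_mul (1 - (l : ℂ))).const_add (l : ℂ)
    refine ((hf w hw).differentiableAt.hasDerivAt.mul
      (((hDd.clog (hDs l hl w hw)).const_mul (b : ℂ)).cexp)).congr_deriv ?_
    have hq := (hA w hw).2.1
    have hpw := hpne w hw
    have h3 := hfd w hw
    have hDX : D l w = l + (1 - l) * (β / (1 + c) * ((deriv f w - α) / p w)) := rfl
    have e : p w * b * N l w * X w = deriv f w * D l w + f w * (b * ((1 - l) * (β / (1 + c) *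
        ((deriv (deriv f) w * p w - (deriv f w - α) * deriv p w) / p w ^ 2)))) := by
      rw [hDX, hfp w]
      simp only [N, A, B, X, b]
      push_cast
      field_simp
      linear_combination -(1 - (l : ℂ)) * (deriv f w - α) * h3
    rw [e]
    field_simp
  · intro l hl w hw hlw
    have hD0 := slitPlane_ne_zero (hDs l hl w hw)
    have hb0 : (b : ℂ) ≠ 0 := Complex.ofReal_ne_zero.2 (one_div_pos.2 hβ0).ne'
    exact mul_ne_zero (exp_ne_zero _) (div_ne_zero (mul_ne_zero (mul_ne_zero (mul_ne_zero
      (hpne w hw) hb0) (hN0 l hl w hw hlw)) (slitPlane_ne_zero (hXs w hw))) hD0)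
  · intro l hl w hw
    have hl' : l ∈ Icc (0 : ℝ) 1 := ⟨hl.1.le, hl.2⟩
    have hl0 : (l : ℂ) ≠ 0 := Complex.ofReal_ne_zero.2 hl.1.ne'
    have hDs' := hDs l hl' w hw
    have hD0 := slitPlane_ne_zero hDs'
    have hNw := hN0 l hl' w hw fun h => absurd h hl.1.ne'
    have hDd : HasDerivAt (fun s : ℂ => s + (1 - s) * X w) (1 + -1 * X w) (l : ℂ) :=
      (hasDerivAt_id _).add (((hasDerivAt_id _).const_sub 1).mul_const _)
    refine ((((hDd.clog hDs').const_mul (b : ℂ)).cexp).const_mul (f w)).congr_deriv ?_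
    change f w * (exp (b * log (D l w)) * (b * ((1 + -1 * X w) / D l w)))
      = b * (f w * exp (b * log (D l w))) / l - _
    rw [hfp w]
    field_simp
    simp only [D]
    ring
  · intro l hl w hw
    have h3 := lt_re_inv_of_norm_sub_ofReal_lt hRpos (hN l hl w hw)
    have e : ((l * N l w)⁻¹).re = ((N l w)⁻¹).re / l := by
      rw [mul_inv, ← ofReal_inv, re_ofReal_mul]
      ring
    rwa [e, div_lt_div_iff_of_pos_right hl.1, ← mul_div_cancel₀ (m + 1) (two_ne_zero' ℝ)]
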